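/- In any 3-quasi-Sasakian manifold, for every cyclic permutation (α,β,γ) of {1,2,3}, the Lie derivative of φ_β along the Reeb vector field ξ_α satisfies L_{ξ_α} φ_β = c ψ_γ, where c is the constant with [ξ_α, ξ_β] = c ξ_γ. -/

import Mathlib

/-!
An abstract (Lie–Rinehart style) algebraic model of the differential geometry of
almost contact metric 3-structures: `F` plays the role of the algebra of smooth
functions on a manifold `M` of dimension `4n+3`, and `V` plays the role of the
`F`-module of smooth vector fields, acting on `F` by derivations and carrying a
Lie bracket, a Riemannian metric `g`, and three almost contact metric structures
`(φ_α, ξ_α, η_α, g)`.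
-/

noncomputable section

namespace QS3

/-- Cyclic (= even) permutations of `{0,1,2}`, modelling even permutations of `{1,2,3}`. -/
def Cyclic (a b c : Fin 3) : Prop :=
  (a, b, c) = (0, 1, 2) ∨ (a, b, c) = (1, 2, 0) ∨ (a, b, c) = (2, 0, 1)

/-- The algebraic model of the smooth structure of a manifold: an `ℝ`-algebra `F`
of smooth functions and an `F`-module `V` of vector fields acting on `F` by
derivations and carrying the Lie bracket of vector fields. -/
class SmoothSetting (F : Type) (V : Type) [CommRing F] [Algebra ℝ F]
    [AddCommGroup V] [Module F V] where
  act : V → F → F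
  bracket : V → V → V
  act_add : ∀ (X : V) (f₁ f₂ : F), act X (f₁ + f₂) = act X f₁ + act X f₂
  act_mul : ∀ (X : V) (f₁ f₂ : F), act X (f₁ * f₂) = act X f₁ * f₂ + f₁ * act X f₂
  act_const : ∀ (X : V) (r : ℝ), act X (algebraMap ℝ F r) = 0
  act_addLeft : ∀ (X Y : V) (f : F), act (X + Y) f = act X f + act Y f
  act_smulLeft : ∀ (f : F) (X : V) (h : F), act (f • X) h = f * act X h
  bracket_antisymm : ∀ X Y : V, bracket X Y = -bracket Y X
  bracket_addLeft : ∀ X Y Z : V, bracket (X + Y) Z = bracket X Z + bracket Y Z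
  bracket_act : ∀ (X Y : V) (f : F),
    act (bracket X Y) f = act X (act Y f) - act Y (act X f)
  bracket_smulRight : ∀ (X : V) (f : F) (Y : V),
    bracket X (f • Y) = f • bracket X Y + act X f • Y
  jacobi : ∀ X Y Z : V,
    bracket X (bracket Y Z) + bracket Y (bracket Z X) + bracket Z (bracket X Y) = 0

section d

variable (F V : Type) [CommRing F] [Algebra ℝ F] [AddCommGroup V] [Module F V]
  [SmoothSetting F V]

/-- The action of a vector field on a function (directional derivative). -/
def der (X : V) (f : F) : F := SmoothSetting.act X f

/-- The Lie bracket of vector fields. -/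
def lie (X Y : V) : V := SmoothSetting.bracket F X Y

/-- Exterior differential of a 1-form (with the `1/2` normalization convention,
so that `2 dθ(X,Y) = X θ(Y) - Y θ(X) - θ([X,Y])`). -/
def dOne (θ : V → F) (X Y : V) : F :=
  (2 : ℝ)⁻¹ • (der F V X (θ Y) - der F V Y (θ X) - θ (lie F V X Y))

/-- Exterior differential of a 2-form (with the `1/3` normalization convention). -/
def dTwo (ω : V → V → F) (X Y Z : V) : F :=
  (3 : ℝ)⁻¹ • (der F V X (ω Y Z) + der F V Y (ω Z X) + der F V Z (ω X Y)
    - ω (lie F V X Y) Z - ω (lie F V Y Z) X - ω (lie F V Z X) Y)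

end d

/-- An almost contact metric 3-structure on a manifold of dimension `4n+3`:
three almost contact metric structures `(φ_α, ξ_α, η_α, g)` satisfying the
quaternionic-type relations, together with a (local) orthonormal frame. -/
class ACM3 (F V : Type) [CommRing F] [Algebra ℝ F] [AddCommGroup V] [Module F V]
    [SmoothSetting F V] where
  n : ℕ
  g : V → V → F
  phi : Fin 3 → V → V
  xi : Fin 3 → V
  eta : Fin 3 → V → F
  g_symm : ∀ X Y, g X Y = g Y X
  g_addLeft : ∀ X Y Z, g (X + Y) Z = g X Z + g Y Z
  g_smulLeft : ∀ (f : F) (X Y : V), g (f • X) Y = f * g X Y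
  g_nondeg : ∀ X, (∀ Y, g X Y = 0) → X = 0
  phi_add : ∀ α (X Y : V), phi α (X + Y) = phi α X + phi α Y
  phi_smul : ∀ α (f : F) (X : V), phi α (f • X) = f • phi α X
  eta_eq : ∀ α X, eta α X = g X (xi α)
  acm_sq : ∀ α X, phi α (phi α X) = -X + eta α X • xi α
  eta_xi : ∀ α, eta α (xi α) = 1
  compat : ∀ α X Y, g (phi α X) (phi α Y) = g X Y - eta α X * eta α Y
  quat_phi : ∀ a b c, Cyclic a b c → ∀ X, phi c X = phi a (phi b X) - eta b X • xi a
  quat_phi' : ∀ a b c, Cyclic a b c → ∀ X, phi c X = -(phi b (phi a X)) + eta a X • xi b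
  quat_xi : ∀ a b c, Cyclic a b c → xi c = phi a (xi b)
  quat_xi' : ∀ a b c, Cyclic a b c → xi c = -(phi b (xi a))
  quat_eta : ∀ a b c, Cyclic a b c → ∀ X, eta c X = eta a (phi b X)
  quat_eta' : ∀ a b c, Cyclic a b c → ∀ X, eta c X = -(eta b (phi a X))
  frame : Fin (4 * n + 3) → V
  frame_orth : ∀ i j, g (frame i) (frame j) = if i = j then 1 else 0
  frame_span : ∀ X : V, X = ∑ i, g X (frame i) • frame i

section acm

variable (F V : Type) [CommRing F] [Algebra ℝ F] [AddCommGroup V] [Module F V]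
  [SmoothSetting F V] [ACM3 F V]

/-- The integer `n` (the manifold has dimension `4n+3`). -/
def dimn : ℕ := ACM3.n F V

/-- The Riemannian metric. -/
def gm (X Y : V) : F := ACM3.g X Y

/-- The structure tensors `φ_α`. -/
def ph (α : Fin 3) (X : V) : V := ACM3.phi F α X

/-- The Reeb vector fields `ξ_α`. -/
def rxi (α : Fin 3) : V := ACM3.xi F α

/-- The 1-forms `η_α`. -/
def et (α : Fin 3) (X : V) : F := ACM3.eta α X

/-- The orthonormal frame. -/
def fr (i : Fin (4 * dimn F V + 3)) : V := ACM3.frame i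

/-- The fundamental 2-form `Φ_α(X,Y) = g(X, φ_α Y)`. -/
def Phi (α : Fin 3) (X Y : V) : F := gm F V X (ph F V α Y)

/-- The Nijenhuis torsion `[φ_α, φ_α]` of `φ_α`. -/
def Nij (α : Fin 3) (X Y : V) : V :=
  ph F V α (ph F V α (lie F V X Y)) + lie F V (ph F V α X) (ph F V α Y)
    - ph F V α (lie F V (ph F V α X) Y) - ph F V α (lie F V X (ph F V α Y))

/-- The normality tensor `N⁽¹⁾_α = [φ_α, φ_α] + 2 dη_α ⊗ ξ_α`. -/
def NOne (α : Fin 3) (X Y : V) : V :=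
  Nij F V α X Y + ((2 : ℝ) • dOne F V (et F V α) X Y) • rxi F V α

/-- The structure `(φ_α, ξ_α, η_α)` is normal. -/
def IsNormal (α : Fin 3) : Prop := ∀ X Y, NOne F V α X Y = 0

/-- A 2-form is closed. -/
def IsClosedTwo (ω : V → V → F) : Prop := ∀ X Y Z, dTwo F V ω X Y Z = 0

/-- The structure `(φ_α, ξ_α, η_α, g)` is quasi-Sasakian: normal with closed
fundamental 2-form. -/
def IsQuasiSasakian (α : Fin 3) : Prop :=
  IsNormal F V α ∧ IsClosedTwo F V (Phi F V α)

/-- `M` is 3-cosymplectic: each structure is normal with `dη_α = 0` and `dΦ_α = 0`. -/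
def ThreeCosymplectic : Prop :=
  ∀ α, IsNormal F V α ∧ (∀ X Y, dOne F V (et F V α) X Y = 0) ∧
    IsClosedTwo F V (Phi F V α)

/-- `M` is 3-α-Sasakian with constant `a ≠ 0`: each structure is normal (an
`α`-Sasakian structure) and `dη_δ = a Φ_δ`. -/
def Is3AlphaSasakianWith (a : ℝ) : Prop :=
  a ≠ 0 ∧ (∀ δ, IsNormal F V δ) ∧
    ∀ (δ : Fin 3) (X Y : V), dOne F V (et F V δ) X Y = algebraMap ℝ F a * Phi F V δ X Y

/-- A vector field is horizontal: it lies in `H = ∩_α ker η_α`. -/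
def Horiz (X : V) : Prop := ∀ α, et F V α X = 0

/-- A vector field is vertical: it lies in `V = ⟨ξ₁, ξ₂, ξ₃⟩`. -/
def InVert (X : V) : Prop :=
  ∃ p q r : F, X = p • rxi F V 0 + q • rxi F V 1 + r • rxi F V 2

/-- The distribution `E^{4m} = {X ∈ H : i_X dη_α = 0}`. -/
def InE4m (X : V) : Prop :=
  Horiz F V X ∧ ∀ (α : Fin 3) (Y : V), dOne F V (et F V α) X Y = 0

/-- The distribution `E^{4l}`: the orthogonal complement of `E^{4m}` in `H`. -/
def InE4l (X : V) : Prop :=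
  Horiz F V X ∧ ∀ Y, InE4m F V Y → gm F V X Y = 0

/-- The distribution `E^{4l+3} = E^{4l} ⊕ V`. -/
def InE4l3 (X : V) : Prop :=
  ∃ Y Z, InE4l F V Y ∧ InVert F V Z ∧ X = Y + Z

/-- The distribution `E^{4m+3} = E^{4m} ⊕ V`. -/
def InE4m3 (X : V) : Prop :=
  ∃ Y Z, InE4m F V Y ∧ InVert F V Z ∧ X = Y + Z

/-- The horizontal component `X_H = X - ∑_α η_α(X) ξ_α` of a vector field. -/
def horComp (X : V) : V := X - ∑ α : Fin 3, et F V α X • rxi F V α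

/-- A vector field is basic with respect to the foliation defined by `E^{4m}`. -/
def BasicE4m (X : V) : Prop :=
  InE4l3 F V X ∧ ∀ W, InE4m F V W → InE4m F V (lie F V W X)

/-- A vector field is basic with respect to the foliation defined by `E^{4l+3}`. -/
def BasicE4l3 (X : V) : Prop :=
  InE4m F V X ∧ ∀ W, InE4l3 F V W → InE4l3 F V (lie F V W X)

end acm

/-- A 3-quasi-Sasakian structure: each of the three almost contact metric
structures is quasi-Sasakian.  We also record, as part of the structure, the
standard structural facts established for such manifolds in the literature
(Cappelletti Montano–De Nicola–Dileo): the Reeb commutation relations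
`[ξ_α, ξ_β] = c ξ_γ`, the splitting `H = E^{4l} ⊕ E^{4m}` (constancy of the
rank), the `φ_α`-invariance of both distributions, and the tensors `ψ_α`
(equal to `φ_α` on `E^{4l+3}` and vanishing on `E^{4m}` when the rank is
`4l+3`, i.e. `c ≠ 0`; equal to `φ_α` on `E^{4l}` and vanishing on `E^{4m+3}`
when the rank is `4l+1`, i.e. `c = 0`). -/
class ThreeQS (F V : Type) [CommRing F] [Algebra ℝ F] [AddCommGroup V] [Module F V]
    [SmoothSetting F V] [ACM3 F V] where
  qs : ∀ α, IsQuasiSasakian F V α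
  c : ℝ
  reeb_bracket : ∀ a b c', Cyclic a b c' →
    lie F V (rxi F V a) (rxi F V b) = algebraMap ℝ F c • rxi F V c'
  horiz_split : ∀ X, Horiz F V X → ∃ Y Z, InE4l F V Y ∧ InE4m F V Z ∧ X = Y + Z
  phi_E4l : ∀ α X, InE4l F V X → InE4l F V (ph F V α X)
  phi_E4m : ∀ α X, InE4m F V X → InE4m F V (ph F V α X)
  psi : Fin 3 → V → V
  psi_add : ∀ α (X Y : V), psi α (X + Y) = psi α X + psi α Y
  psi_smul : ∀ α (f : F) (X : V), psi α (f • X) = f • psi α X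
  psi_E4l : ∀ α X, InE4l F V X → psi α X = ph F V α X
  psi_E4m : ∀ α X, InE4m F V X → psi α X = 0
  psi_vert_of_ne : c ≠ 0 → ∀ α β, psi α (rxi F V β) = ph F V α (rxi F V β)
  psi_vert_of_eq : c = 0 → ∀ α β, psi α (rxi F V β) = 0

section tqs

variable (F V : Type) [CommRing F] [Algebra ℝ F] [AddCommGroup V] [Module F V]
  [SmoothSetting F V] [ACM3 F V] [ThreeQS F V]

/-- The constant `c` with `[ξ_α, ξ_β] = c ξ_γ`. -/
def cc : ℝ := ThreeQS.c F V

/-- The tensors `ψ_α`. -/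
def psiT (α : Fin 3) (X : V) : V := ThreeQS.psi F α X

/-- The tensors `θ_α = φ_α - ψ_α`. -/
def thetaT (α : Fin 3) (X : V) : V := ph F V α X - psiT F V α X

/-- The 2-forms `Θ_α(X,Y) = g(X, θ_α Y)`. -/
def ThetaForm (α : Fin 3) (X Y : V) : F := gm F V X (thetaT F V α Y)

end tqs

/-- The 3-quasi-Sasakian manifold has rank `4l+3`: the constant `c` is nonzero
and the orthonormal frame is adapted to the splitting
`TM = E^{4l} ⊕ E^{4m} ⊕ ⟨ξ₁,ξ₂,ξ₃⟩` with `dim E^{4l} = 4l` (hence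
`dim E^{4m} = 4m`, `m = n - l`, and the rank of the `η_α` is `4l+3`). -/
class HasRank (F V : Type) [CommRing F] [Algebra ℝ F] [AddCommGroup V] [Module F V]
    [SmoothSetting F V] [ACM3 F V] [ThreeQS F V] (l : ℕ) : Prop where
  c_ne : cc F V ≠ 0
  l_le : l ≤ dimn F V
  frame_E4l : ∀ i : Fin (4 * dimn F V + 3), i.val < 4 * l → InE4l F V (fr F V i)
  frame_E4m : ∀ i : Fin (4 * dimn F V + 3), 4 * l ≤ i.val → i.val < 4 * dimn F V →
    InE4m F V (fr F V i)
  frame_xi : ∀ (i : Fin (4 * dimn F V + 3)) (a : Fin 3),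
    i.val = 4 * dimn F V + a.val → fr F V i = rxi F V a

/-- The Levi-Civita connection of `g`: the unique torsion-free metric connection. -/
class LeviCivita (F V : Type) [CommRing F] [Algebra ℝ F] [AddCommGroup V] [Module F V]
    [SmoothSetting F V] [ACM3 F V] where
  nabla : V → V → V
  nabla_addLeft : ∀ X Y Z : V, nabla (X + Y) Z = nabla X Z + nabla Y Z
  nabla_smulLeft : ∀ (f : F) (X Y : V), nabla (f • X) Y = f • nabla X Y
  nabla_addRight : ∀ X Y Z : V, nabla X (Y + Z) = nabla X Y + nabla X Z
  nabla_leibniz : ∀ (X : V) (f : F) (Y : V),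
    nabla X (f • Y) = der F V X f • Y + f • nabla X Y
  nabla_metric : ∀ X Y Z : V,
    der F V X (gm F V Y Z) = gm F V (nabla X Y) Z + gm F V Y (nabla X Z)
  nabla_torsionFree : ∀ X Y : V, nabla X Y - nabla Y X = lie F V X Y

section curv

variable (F V : Type) [CommRing F] [Algebra ℝ F] [AddCommGroup V] [Module F V]
  [SmoothSetting F V] [ACM3 F V] [LeviCivita F V]

/-- The Levi-Civita covariant derivative `∇_X Y`. -/
def nab (X Y : V) : V := LeviCivita.nabla F X Y

/-- The Riemannian curvature `R(X,Y)Z = ∇_X ∇_Y Z - ∇_Y ∇_X Z - ∇_{[X,Y]} Z`. -/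
def Rcurv (X Y Z : V) : V :=
  nab F V X (nab F V Y Z) - nab F V Y (nab F V X Z) - nab F V (lie F V X Y) Z

/-- The Ricci tensor `Ric(X,Y) = ∑_i g(R(e_i, X)Y, e_i)`. -/
def Ric (X Y : V) : F :=
  ∑ i, gm F V (Rcurv F V (fr F V i) X Y) (fr F V i)

/-- The scalar curvature. -/
def Scal : F := ∑ i, Ric F V (fr F V i) (fr F V i)

/-- `M` is Einstein: `Ric = a g` for a constant `a`. -/
def Einstein : Prop :=
  ∃ a : ℝ, ∀ X Y, Ric F V X Y = algebraMap ℝ F a * gm F V X Y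

/-- `M` is η-Einstein: `Ric = a g + b ∑_α η_α ⊗ η_α` for constants `a, b`. -/
def EtaEinstein : Prop :=
  ∃ a b : ℝ, ∀ X Y, Ric F V X Y
    = algebraMap ℝ F a * gm F V X Y
      + algebraMap ℝ F b * ∑ α : Fin 3, et F V α X * et F V α Y

end curv

/-- A (Koszul) linear connection on vector fields. -/
def IsConnection (F V : Type) [CommRing F] [Algebra ℝ F] [AddCommGroup V] [Module F V]
    [SmoothSetting F V] (D : V → V → V) : Prop :=
  (∀ X Y Z : V, D (X + Y) Z = D X Z + D Y Z) ∧
  (∀ (f : F) (X Y : V), D (f • X) Y = f • D X Y) ∧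
  (∀ X Y Z : V, D X (Y + Z) = D X Y + D X Z) ∧
  (∀ (X : V) (f : F) (Y : V), D X (f • Y) = der F V X f • Y + f • D X Y)

end QS3

namespace QS3

section Basic

theorem Cyclic.rotate {a b c : Fin 3} (h : Cyclic a b c) : Cyclic b c a := by
  unfold Cyclic at *; grind

theorem Cyclic.exhaust {a b c : Fin 3} (h : Cyclic a b c) (d : Fin 3) :
    d = a ∨ d = b ∨ d = c := by
  unfold Cyclic at *; grind

theorem Cyclic.sum_eq {M : Type} [AddCommMonoid M] {a b c : Fin 3} (h : Cyclic a b c)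
    (f : Fin 3 → M) : ∑ i, f i = f a + f b + f c := by
  rw [Fin.sum_univ_three]
  rcases h with h | h | h <;> simp only [Prod.mk.injEq] at h <;>
    obtain ⟨rfl, rfl, rfl⟩ := h <;> abel

theorem exists_cyclic (a : Fin 3) : ∃ b c, Cyclic a b c := by
  fin_cases a
  · exact ⟨1, 2, Or.inl rfl⟩
  · exact ⟨2, 0, Or.inr (Or.inl rfl)⟩
  · exact ⟨0, 1, Or.inr (Or.inr rfl)⟩

theorem eq_zero_of_eq_neg (F : Type) {V : Type} [CommRing F] [Algebra ℝ F] [AddCommGroup V]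
    [Module F V] {x : V} (h : x = -x) : x = 0 := by
  have h2 : algebraMap ℝ F 2 • x = 0 := by
    rw [map_ofNat, ofNat_smul_eq_nsmul, two_nsmul]
    nth_rewrite 1 [h]
    simp
  calc x = (algebraMap ℝ F (2⁻¹) * algebraMap ℝ F 2) • x := by
        rw [← map_mul]; norm_num
    _ = 0 := by rw [mul_smul, h2, smul_zero]

variable {F V : Type} [CommRing F] [Algebra ℝ F] [AddCommGroup V] [Module F V]
  [SmoothSetting F V]

theorem lie_neg_swap (X Y : V) : lie F V X Y = -lie F V Y X :=
  SmoothSetting.bracket_antisymm X Y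

theorem lie_add_left (X Y Z : V) : lie F V (X + Y) Z = lie F V X Z + lie F V Y Z :=
  SmoothSetting.bracket_addLeft X Y Z

theorem lie_add_right (X Y Z : V) : lie F V X (Y + Z) = lie F V X Y + lie F V X Z := by
  rw [lie_neg_swap, lie_add_left, lie_neg_swap Y, lie_neg_swap Z]; abel

variable (F V) in
/-- The bracket with a fixed vector field as an additive map. -/
def lieHom (X : V) : V →+ V := AddMonoidHom.mk' (lie F V X) (lie_add_right X)

theorem lie_zero_right (X : V) : lie F V X 0 = 0 := (lieHom F V X).map_zero

theorem lie_neg_right (X Y : V) : lie F V X (-Y) = -lie F V X Y := (lieHom F V X).map_neg Y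

theorem lie_sub_right (X Y Z : V) : lie F V X (Y - Z) = lie F V X Y - lie F V X Z :=
  (lieHom F V X).map_sub Y Z

theorem lie_smul_right (X : V) (f : F) (Y : V) :
    lie F V X (f • Y) = f • lie F V X Y + der F V X f • Y :=
  SmoothSetting.bracket_smulRight X f Y

theorem der_add (X : V) (f h : F) : der F V X (f + h) = der F V X f + der F V X h :=
  SmoothSetting.act_add X f h

variable (F V) in
/-- The directional derivative along a fixed vector field as an additive map. -/
def derHom (X : V) : F →+ F := AddMonoidHom.mk' (der F V X) (der_add X)

theorem der_zero (X : V) : der F V X (0 : F) = 0 := (derHom F V X).map_zero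

theorem der_neg (X : V) (f : F) : der F V X (-f) = -der F V X f := (derHom F V X).map_neg f

theorem der_sub (X : V) (f h : F) : der F V X (f - h) = der F V X f - der F V X h :=
  (derHom F V X).map_sub f h

theorem der_mul (X : V) (f h : F) :
    der F V X (f * h) = der F V X f * h + f * der F V X h :=
  SmoothSetting.act_mul X f h

theorem der_const (X : V) (r : ℝ) : der F V X (algebraMap ℝ F r) = 0 :=
  SmoothSetting.act_const X r

theorem der_one (X : V) : der F V X (1 : F) = 0 := by
  rw [← map_one (algebraMap ℝ F), der_const]

theorem lie_const_smul_right (X : V) (r : ℝ) (Y : V) :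
    lie F V X (algebraMap ℝ F r • Y) = algebraMap ℝ F r • lie F V X Y := by
  rw [lie_smul_right, der_const, zero_smul, add_zero]

theorem lie_const_smul_left (r : ℝ) (X Y : V) :
    lie F V (algebraMap ℝ F r • X) Y = algebraMap ℝ F r • lie F V X Y := by
  rw [lie_neg_swap, lie_const_smul_right, lie_neg_swap Y, smul_neg, neg_neg]

theorem lie_self (X : V) : lie F V X X = 0 :=
  eq_zero_of_eq_neg F (lie_neg_swap X X)

theorem lie_lie (X Y Z : V) :
    lie F V X (lie F V Y Z) = lie F V (lie F V X Y) Z + lie F V Y (lie F V X Z) := by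
  have h : lie F V X (lie F V Y Z) + lie F V Y (lie F V Z X) + lie F V Z (lie F V X Y) = 0 :=
    SmoothSetting.jacobi X Y Z
  rw [lie_neg_swap Z X, lie_neg_right, lie_neg_swap Z] at h
  rw [← sub_eq_zero, ← h]; abel

theorem two_smul_dOne (θ : V → F) (X Y : V) :
    (2 : ℝ) • dOne F V θ X Y = der F V X (θ Y) - der F V Y (θ X) - θ (lie F V X Y) := by
  rw [dOne, smul_smul]; norm_num

theorem IsClosedTwo.der_eq {ω : V → V → F} (hω : IsClosedTwo F V ω) (X Y Z : V) :
    der F V X (ω Y Z) + der F V Y (ω Z X) + der F V Z (ω X Y)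
      - ω (lie F V X Y) Z - ω (lie F V Y Z) X - ω (lie F V Z X) Y = 0 := by
  have h := congrArg ((3 : ℝ) • ·) (hω X Y Z)
  simp only [dTwo, smul_smul, smul_zero] at h
  norm_num at h
  exact h

end Basic

section AlmostContact

variable {F V : Type} [CommRing F] [Algebra ℝ F] [AddCommGroup V] [Module F V]
  [SmoothSetting F V] [ACM3 F V]

theorem gm_comm (X Y : V) : gm F V X Y = gm F V Y X := ACM3.g_symm X Y

variable (F V) in
/-- The metric as a bilinear form. -/
def gmLin : V →ₗ[F] V →ₗ[F] F :=
  LinearMap.mk₂ F (gm F V) ACM3.g_addLeft ACM3.g_smulLeft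
    (fun X Y Z => by
      rw [gm_comm, gm_comm X Y, gm_comm X Z]; exact ACM3.g_addLeft Y Z X)
    (fun f X Y => by
      rw [gm_comm, gm_comm X Y]; exact ACM3.g_smulLeft f Y X)

theorem gm_add_left (X Y Z : V) : gm F V (X + Y) Z = gm F V X Z + gm F V Y Z :=
  (gmLin F V).map_add₂ X Y Z

theorem gm_add_right (X Y Z : V) : gm F V X (Y + Z) = gm F V X Y + gm F V X Z :=
  (gmLin F V X).map_add Y Z

theorem gm_neg_right (X Y : V) : gm F V X (-Y) = -gm F V X Y := (gmLin F V X).map_neg Y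

theorem gm_neg_left (X Y : V) : gm F V (-X) Y = -gm F V X Y := (gmLin F V).map_neg₂ X Y

theorem gm_sub_right (X Y Z : V) : gm F V X (Y - Z) = gm F V X Y - gm F V X Z :=
  (gmLin F V X).map_sub Y Z

theorem gm_smul_right (f : F) (X Y : V) : gm F V X (f • Y) = f * gm F V X Y :=
  (gmLin F V X).map_smul f Y

theorem gm_zero_right (X : V) : gm F V X 0 = 0 := (gmLin F V X).map_zero

theorem gm_zero_left (X : V) : gm F V 0 X = 0 := (gmLin F V).map_zero₂ X

variable (F) in
theorem eq_of_gm_eq {X Y : V} (h : ∀ Z, gm F V Z X = gm F V Z Y) : X = Y := by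
  rw [← sub_eq_zero]
  refine ACM3.g_nondeg (F := F) _ fun Z => ?_
  change gm F V (X - Y) Z = 0
  rw [gm_comm, gm_sub_right, h, sub_self]

variable (F V) in
/-- The structure tensor `φ_α` as a linear map. -/
def phLin (α : Fin 3) : V →ₗ[F] V where
  toFun := ph F V α
  map_add' := ACM3.phi_add α
  map_smul' := ACM3.phi_smul α

theorem ph_add (α : Fin 3) (X Y : V) : ph F V α (X + Y) = ph F V α X + ph F V α Y :=
  (phLin F V α).map_add X Y

theorem ph_sub (α : Fin 3) (X Y : V) : ph F V α (X - Y) = ph F V α X - ph F V α Y :=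
  (phLin F V α).map_sub X Y

theorem ph_neg (α : Fin 3) (X : V) : ph F V α (-X) = -ph F V α X := (phLin F V α).map_neg X

theorem ph_zero (α : Fin 3) : ph F V α 0 = 0 := (phLin F V α).map_zero

theorem ph_smul (α : Fin 3) (f : F) (X : V) : ph F V α (f • X) = f • ph F V α X :=
  (phLin F V α).map_smul f X

theorem et_eq (α : Fin 3) (X : V) : et F V α X = gm F V X (rxi F V α) := ACM3.eta_eq α X

theorem et_add (α : Fin 3) (X Y : V) : et F V α (X + Y) = et F V α X + et F V α Y := by
  simp only [et_eq, gm_add_left]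

theorem et_neg (α : Fin 3) (X : V) : et F V α (-X) = -et F V α X := by
  simp only [et_eq, gm_neg_left]

theorem et_zero (α : Fin 3) : et F V α (0 : V) = 0 := by
  simp only [et_eq, gm_zero_left]

theorem et_sub (α : Fin 3) (X Y : V) : et F V α (X - Y) = et F V α X - et F V α Y := by
  rw [sub_eq_add_neg, et_add, et_neg, sub_eq_add_neg]

theorem et_smul (α : Fin 3) (f : F) (X : V) : et F V α (f • X) = f * et F V α X := by
  simp only [et_eq, gm_comm _ (rxi F V α), gm_smul_right]

theorem ph_ph (α : Fin 3) (X : V) :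
    ph F V α (ph F V α X) = -X + et F V α X • rxi F V α := ACM3.acm_sq α X

theorem et_rxi_self (α : Fin 3) : et F V α (rxi F V α) = 1 := ACM3.eta_xi α

theorem eq_zero_of_smul_rxi {α : Fin 3} {f : F} (h : f • rxi F V α = 0) : f = 0 := by
  have := congrArg (et F V α) h
  rwa [et_smul, et_rxi_self, mul_one, et_zero] at this

theorem gm_ph_ph (α : Fin 3) (X Y : V) :
    gm F V (ph F V α X) (ph F V α Y) = gm F V X Y - et F V α X * et F V α Y :=
  ACM3.compat α X Y

variable {a b c : Fin 3}

theorem ph_rxi_right (h : Cyclic a b c) : ph F V a (rxi F V b) = rxi F V c :=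
  (ACM3.quat_xi a b c h).symm

theorem ph_rxi_left (h : Cyclic a b c) : ph F V b (rxi F V a) = -rxi F V c :=
  neg_eq_iff_eq_neg.mp (ACM3.quat_xi' a b c h).symm

theorem ph_eq (h : Cyclic a b c) (X : V) :
    ph F V c X = ph F V a (ph F V b X) - et F V b X • rxi F V a := ACM3.quat_phi a b c h X

theorem ph_eq' (h : Cyclic a b c) (X : V) :
    ph F V c X = -ph F V b (ph F V a X) + et F V a X • rxi F V b := ACM3.quat_phi' a b c h X

theorem et_ph_right (h : Cyclic a b c) (X : V) : et F V a (ph F V b X) = et F V c X :=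
  (ACM3.quat_eta a b c h X).symm

theorem et_ph_left (h : Cyclic a b c) (X : V) : et F V b (ph F V a X) = -et F V c X :=
  neg_eq_iff_eq_neg.mp (ACM3.quat_eta' a b c h X).symm

theorem et_rxi_of_cyclic (h : Cyclic a b c) : et F V a (rxi F V b) = 0 := by
  have h1 := ph_ph (F := F) a (rxi F V b)
  rw [ph_rxi_right h, ph_rxi_left h.rotate.rotate] at h1
  exact eq_zero_of_smul_rxi (left_eq_add.mp h1)

theorem et_rxi_of_cyclic' (h : Cyclic a b c) : et F V b (rxi F V a) = 0 := by
  rw [et_eq, gm_comm, ← et_eq, et_rxi_of_cyclic h]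

theorem ph_rxi_self (b : Fin 3) : ph F V b (rxi F V b) = 0 := by
  obtain ⟨c, a, h⟩ := exists_cyclic b
  have h1 := ph_eq (F := F) h.rotate.rotate (rxi F V b)
  rw [ph_rxi_left h, et_rxi_self, one_smul, eq_comm, sub_eq_add_neg, add_eq_right] at h1
  have h2 := ph_ph (F := F) a (ph F V b (rxi F V b))
  rw [h1, ph_zero, et_ph_right h.rotate.rotate, et_rxi_of_cyclic' h, zero_smul, add_zero] at h2
  simpa using h2.symm

theorem et_ph_self (α : Fin 3) (X : V) : et F V α (ph F V α X) = 0 := by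
  have h1 := congrArg (ph F V α) (ph_ph (F := F) α X)
  rw [ph_ph, ph_add, ph_neg, ph_smul, ph_rxi_self, smul_zero, add_zero] at h1
  exact eq_zero_of_smul_rxi (add_eq_left.mp h1)

theorem gm_ph_right (α : Fin 3) (X Y : V) :
    gm F V X (ph F V α Y) = -gm F V (ph F V α X) Y := by
  have h1 := gm_ph_ph (F := F) α X (ph F V α Y)
  rw [et_ph_self, mul_zero, sub_zero, ph_ph, gm_add_right, gm_neg_right, gm_smul_right, ← et_eq,
    et_ph_self, mul_zero, add_zero] at h1
  exact h1.symm

theorem horiz_ph {X : V} (hX : Horiz F V X) (α : Fin 3) : Horiz F V (ph F V α X) := by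
  obtain ⟨b, c, h⟩ := exists_cyclic α
  intro d
  rcases h.exhaust d with rfl | rfl | rfl
  · exact et_ph_self _ X
  · rw [et_ph_left h, hX, neg_zero]
  · rw [et_ph_right h.rotate.rotate, hX]

theorem Horiz.ph_ph {X : V} (hX : Horiz F V X) (α : Fin 3) :
    ph F V α (ph F V α X) = -X := by
  rw [QS3.ph_ph, hX, zero_smul, add_zero]

theorem Horiz.ph_comp {X : V} (hX : Horiz F V X) (h : Cyclic a b c) :
    ph F V a (ph F V b X) = ph F V c X := by
  rw [ph_eq h, hX, zero_smul, sub_zero]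

theorem Horiz.ph_comp' {X : V} (hX : Horiz F V X) (h : Cyclic a b c) :
    ph F V b (ph F V a X) = -ph F V c X := by
  rw [ph_eq' h, hX, zero_smul, add_zero, neg_neg]

theorem Horiz.sub {X Y : V} (hX : Horiz F V X) (hY : Horiz F V Y) : Horiz F V (X - Y) :=
  fun α => by rw [et_sub, hX, hY, sub_zero]

theorem Horiz.smul {X : V} (hX : Horiz F V X) (f : F) : Horiz F V (f • X) :=
  fun α => by rw [et_smul, hX, mul_zero]

theorem horiz_horComp (X : V) : Horiz F V (horComp F V X) := by
  intro α
  obtain ⟨b, c, h⟩ := exists_cyclic α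
  rw [horComp, h.sum_eq, et_sub, et_add, et_add, et_smul, et_smul, et_smul, et_rxi_self,
    et_rxi_of_cyclic h, et_rxi_of_cyclic' h.rotate.rotate]
  ring

theorem horComp_add_sum (X : V) :
    X = horComp F V X + ∑ α : Fin 3, et F V α X • rxi F V α := by
  rw [horComp, sub_add_cancel]

theorem two_smul_dOne_et_swap (α : Fin 3) (X Y : V) :
    (2 : ℝ) • dOne F V (et F V α) X Y = -((2 : ℝ) • dOne F V (et F V α) Y X) := by
  rw [two_smul_dOne, two_smul_dOne, lie_neg_swap X, et_neg]; ring

variable (F V) in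
/-- The Lie derivative `L_{ξ_a} φ_b`. -/
def lieRxiPh (a b : Fin 3) (X : V) : V :=
  lie F V (rxi F V a) (ph F V b X) - ph F V b (lie F V (rxi F V a) X)

theorem lie_rxi_ph (a b : Fin 3) (X : V) :
    lie F V (rxi F V a) (ph F V b X)
      = lieRxiPh F V a b X + ph F V b (lie F V (rxi F V a) X) := by
  rw [lieRxiPh, sub_add_cancel]

variable (F V) in
/-- The Lie derivative `L_{ξ_a} φ_b` as a linear map. -/
def lieRxiPhLin (a b : Fin 3) : V →ₗ[F] V where
  toFun := lieRxiPh F V a b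
  map_add' X Y := by
    simp only [lieRxiPh, ph_add, lie_add_right]; abel
  map_smul' f X := by
    simp only [lieRxiPh, ph_add, ph_smul, lie_smul_right, smul_sub, RingHom.id_apply]; abel

theorem lie_lieRxiPh (a d e : Fin 3) (X : V) :
    lie F V (rxi F V a) (lieRxiPh F V d e X) - lieRxiPh F V d e (lie F V (rxi F V a) X)
      = lie F V (lie F V (rxi F V a) (rxi F V d)) (ph F V e X)
        - ph F V e (lie F V (lie F V (rxi F V a) (rxi F V d)) X)
        + (lie F V (rxi F V d) (lieRxiPh F V a e X)
          - lieRxiPh F V a e (lie F V (rxi F V d) X)) := by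
  simp only [lieRxiPh, lie_sub_right, lie_lie (rxi F V a) (rxi F V d), ph_add]
  abel

/-- On an almost contact metric structure normality forces `i_ξ dη = 0`. -/
theorem IsNormal.et_lie_rxi {α : Fin 3} (hN : IsNormal F V α) (X : V) :
    et F V α (lie F V (rxi F V α) X) = der F V (rxi F V α) (et F V α X) := by
  have h := hN (rxi F V α) X
  have h1 := congrArg (et F V α) h
  rw [NOne, Nij, ph_rxi_self, two_smul_dOne, et_rxi_self, lie_neg_swap 0, lie_zero_right,
    neg_zero, lie_neg_swap 0, lie_zero_right, neg_zero, ph_zero] at h1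
  rw [et_add, et_sub, et_sub, et_add, et_ph_self, et_ph_self, et_zero, et_smul, et_rxi_self,
    der_one] at h1
  linear_combination -h1

theorem IsNormal.lie_rxi_ph {α : Fin 3} (hN : IsNormal F V α) (X : V) :
    lie F V (rxi F V α) (ph F V α X) = ph F V α (lie F V (rxi F V α) X) := by
  have h := hN (rxi F V α) X
  rw [NOne, Nij, ph_rxi_self, two_smul_dOne, et_rxi_self, lie_neg_swap 0, lie_zero_right,
    neg_zero, lie_neg_swap 0, lie_zero_right, neg_zero, ph_zero, hN.et_lie_rxi,
    der_one, sub_zero (der F V _ _), sub_self, zero_smul, add_zero, add_zero,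
    sub_zero, ← ph_sub] at h
  have h1 := congrArg (ph F V α) h
  rw [QS3.ph_ph, ph_zero, et_sub, et_ph_self, hN.et_lie_rxi, et_ph_self, der_zero, sub_zero,
    zero_smul, add_zero, neg_eq_zero, sub_eq_zero] at h1
  exact h1.symm

/-- The Reeb vector field of a quasi-Sasakian structure is Killing. -/
theorem IsQuasiSasakian.der_gm {α : Fin 3} (hq : IsQuasiSasakian F V α) (X Y : V) :
    der F V (rxi F V α) (gm F V X Y)
      = gm F V (lie F V (rxi F V α) X) Y + gm F V X (lie F V (rxi F V α) Y) := by
  obtain ⟨hN, hC⟩ := hq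
  have h := hC.der_eq (rxi F V α) (ph F V α X) Y
  simp only [Phi, ph_rxi_self, gm_zero_right, der_zero, gm_ph_ph] at h
  rw [gm_comm (rxi F V α), ← et_eq, et_ph_self, der_zero, hN.lie_rxi_ph, gm_ph_ph,
    lie_neg_swap Y, gm_neg_left, ph_ph, gm_add_right, gm_neg_right, gm_smul_right, ← et_eq,
    gm_comm _ X, der_sub, der_mul, hN.et_lie_rxi, hN.et_lie_rxi] at h
  linear_combination h

end AlmostContact

section QuasiSasakian

variable {F V : Type} [CommRing F] [Algebra ℝ F] [AddCommGroup V] [Module F V]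
  [SmoothSetting F V] [ACM3 F V] [ThreeQS F V] {a b c : Fin 3}

theorem der_rxi_gm (α : Fin 3) (X Y : V) :
    der F V (rxi F V α) (gm F V X Y)
      = gm F V (lie F V (rxi F V α) X) Y + gm F V X (lie F V (rxi F V α) Y) :=
  (ThreeQS.qs α).der_gm X Y

theorem lie_rxi_ph_self (α : Fin 3) (X : V) :
    lie F V (rxi F V α) (ph F V α X) = ph F V α (lie F V (rxi F V α) X) :=
  (ThreeQS.qs α).1.lie_rxi_ph X

theorem lie_rxi_rxi (h : Cyclic a b c) :
    lie F V (rxi F V a) (rxi F V b) = algebraMap ℝ F (cc F V) • rxi F V c :=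
  ThreeQS.reeb_bracket a b c h

theorem lie_rxi_rxi' (h : Cyclic a b c) :
    lie F V (rxi F V b) (rxi F V a) = -(algebraMap ℝ F (cc F V) • rxi F V c) := by
  rw [lie_neg_swap, lie_rxi_rxi h]

theorem Horiz.lie_rxi {X : V} (hX : Horiz F V X) (a : Fin 3) :
    Horiz F V (lie F V (rxi F V a) X) := by
  intro d
  have hd : gm F V X (lie F V (rxi F V a) (rxi F V d)) = 0 := by
    obtain ⟨b, c, h⟩ := exists_cyclic a
    rcases h.exhaust d with rfl | rfl | rfl
    · rw [lie_self, gm_zero_right]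
    · rw [lie_rxi_rxi h, gm_smul_right, ← et_eq, hX, mul_zero]
    · rw [lie_rxi_rxi' h.rotate.rotate, gm_neg_right, gm_smul_right, ← et_eq, hX, mul_zero,
        neg_zero]
  have h := der_rxi_gm (F := F) a X (rxi F V d)
  rw [← et_eq, ← et_eq, hX, der_zero, hd, add_zero] at h
  exact h.symm

theorem gm_lieRxiPh (h : Cyclic a b c) (X Y : V) :
    gm F V X (lieRxiPh F V a b Y) = (2 : ℝ) • dOne F V (et F V c) X Y := by
  have h1 := (ThreeQS.qs (F := F) (V := V) b).2.der_eq (rxi F V a) X Y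
  simp only [Phi, ph_rxi_left h, gm_neg_right, ← et_eq, der_neg, der_rxi_gm] at h1
  rw [gm_comm (rxi F V a) (ph F V b X), ← et_eq, et_ph_right h, lie_neg_swap Y, gm_neg_left,
    gm_ph_right b _ X, gm_comm _ X, lie_rxi_ph, gm_add_right] at h1
  rw [two_smul_dOne]
  linear_combination h1

theorem gm_lieRxiPh' (h : Cyclic a b c) (X Y : V) :
    gm F V X (lieRxiPh F V b a Y) = -((2 : ℝ) • dOne F V (et F V c) X Y) := by
  have h1 := (ThreeQS.qs (F := F) (V := V) a).2.der_eq (rxi F V b) X Y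
  simp only [Phi, ph_rxi_right h, ← et_eq, der_rxi_gm] at h1
  rw [gm_comm (rxi F V b) (ph F V a X), ← et_eq, et_ph_left h, der_neg, lie_neg_swap Y,
    gm_neg_left, gm_ph_right a _ X, gm_comm _ X, lie_rxi_ph, gm_add_right] at h1
  rw [two_smul_dOne]
  linear_combination h1

theorem lieRxiPh_swap (h : Cyclic a b c) (X : V) :
    lieRxiPh F V b a X = -lieRxiPh F V a b X :=
  eq_of_gm_eq F fun Z => by rw [gm_lieRxiPh' h, gm_neg_right, gm_lieRxiPh h]

theorem lieRxiPh_self (a : Fin 3) (X : V) : lieRxiPh F V a a X = 0 := by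
  rw [lieRxiPh, lie_rxi_ph_self, sub_self]

theorem Horiz.lieRxiPh {X : V} (hX : Horiz F V X) (a b : Fin 3) :
    Horiz F V (lieRxiPh F V a b X) :=
  ((horiz_ph hX b).lie_rxi a).sub (horiz_ph (hX.lie_rxi a) b)

theorem Horiz.lieRxiPh_eq_neg_ph {X : V} (hX : Horiz F V X) (h : Cyclic a b c) :
    QS3.lieRxiPh F V c a X = -ph F V a (QS3.lieRxiPh F V a b X) := by
  rw [← neg_eq_iff_eq_neg, ← lieRxiPh_swap h.rotate.rotate, QS3.lieRxiPh, QS3.lieRxiPh,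
    ← hX.ph_comp h, lie_rxi_ph_self, ← (hX.lie_rxi a).ph_comp h, ph_sub]

theorem Horiz.lieRxiPh_eq_comp_ph {X : V} (hX : Horiz F V X) (h : Cyclic a b c) :
    QS3.lieRxiPh F V c a X = QS3.lieRxiPh F V a b (ph F V a X) := by
  rw [← neg_neg (QS3.lieRxiPh F V c a X), ← lieRxiPh_swap h.rotate.rotate, QS3.lieRxiPh,
    QS3.lieRxiPh, ← neg_neg (ph F V c X), ← hX.ph_comp' h, lie_rxi_ph_self,
    ← neg_neg (ph F V c _), ← (hX.lie_rxi a).ph_comp' h, lie_neg_right]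
  abel

theorem Horiz.ph_lieRxiPh_eq {X : V} (hX : Horiz F V X) (h : Cyclic a b c) :
    ph F V c (QS3.lieRxiPh F V a b X) = ph F V b (QS3.lieRxiPh F V c a X) := by
  rw [hX.lieRxiPh_eq_neg_ph h, ph_neg, (hX.lieRxiPh a b).ph_comp' h, neg_neg]

theorem Horiz.lieRxiPh_ph_comm {X : V} (hX : Horiz F V X) (h : Cyclic a b c) :
    QS3.lieRxiPh F V c a (ph F V b X) = ph F V b (QS3.lieRxiPh F V c a X) := by
  rw [hX.ph_lieRxiPh_eq h.rotate.rotate, (horiz_ph hX b).lieRxiPh_eq_neg_ph h,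
    (horiz_ph hX b).lieRxiPh_eq_comp_ph h.rotate, hX.ph_ph]
  change -ph F V a (lieRxiPhLin F V b c (-X)) = ph F V a (lieRxiPhLin F V b c X)
  rw [map_neg, ph_neg, neg_neg]

theorem lie_rxi_lieRxiPh (h : Cyclic a b c) (X : V) :
    lie F V (rxi F V a) (lieRxiPh F V c a X)
      = lieRxiPh F V c a (lie F V (rxi F V a) X)
        + algebraMap ℝ F (cc F V) • lieRxiPh F V a b X := by
  rw [← sub_eq_iff_eq_add', lie_lieRxiPh, lie_rxi_rxi' h.rotate.rotate, ← neg_smul, ← map_neg,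
    lie_const_smul_left, lie_const_smul_left, ph_smul, lieRxiPh_self, lieRxiPh_self,
    lie_zero_right, sub_zero, add_zero, ← smul_sub, map_neg, neg_smul, ← smul_neg,
    ← neg_neg (lieRxiPh F V a b X), ← lieRxiPh_swap h, lieRxiPh]

theorem lie_rxi_lieRxiPh_rotate (h : Cyclic a b c) (X : V) :
    lie F V (rxi F V a) (lieRxiPh F V b c X) - lieRxiPh F V b c (lie F V (rxi F V a) X)
      = -(lie F V (rxi F V b) (lieRxiPh F V c a X)
          - lieRxiPh F V c a (lie F V (rxi F V b) X)) := by
  rw [lie_lieRxiPh, lie_rxi_rxi h, lie_const_smul_left, lie_const_smul_left, ph_smul, ← smul_sub,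
    lie_rxi_ph_self, sub_self, smul_zero, zero_add, lieRxiPh_swap h.rotate.rotate,
    lieRxiPh_swap h.rotate.rotate, lie_neg_right]
  abel

theorem lie_rxi_lieRxiPh_self (h : Cyclic a b c) (X : V) :
    lie F V (rxi F V a) (lieRxiPh F V b c X) = lieRxiPh F V b c (lie F V (rxi F V a) X) := by
  rw [← sub_eq_zero]
  refine eq_zero_of_eq_neg F ((lie_rxi_lieRxiPh_rotate h X).trans ?_)
  rw [lie_rxi_lieRxiPh_rotate h.rotate, neg_neg, lie_rxi_lieRxiPh_rotate h.rotate.rotate]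

theorem Horiz.lieRxiPh_lieRxiPh {X : V} (hX : Horiz F V X) (h : Cyclic a b c) :
    QS3.lieRxiPh F V c a (QS3.lieRxiPh F V c a X)
      = algebraMap ℝ F (cc F V) • ph F V c (QS3.lieRxiPh F V a b X) := by
  have h1 := lie_rxi_lieRxiPh_self (F := F) h X
  rw [hX.lieRxiPh_eq_neg_ph h.rotate.rotate, (hX.lie_rxi a).lieRxiPh_eq_neg_ph h.rotate.rotate,
    lie_neg_right, neg_inj, lie_rxi_ph, lieRxiPh_swap h.rotate.rotate, lie_rxi_lieRxiPh h,
    ph_add, ph_smul] at h1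
  rw [← sub_eq_zero, ← sub_eq_zero.mpr h1.symm]
  abel

theorem lieRxiPh_of_InE4m (h : Cyclic a b c) {X : V} (hX : InE4m F V X) :
    lieRxiPh F V a b X = 0 :=
  eq_of_gm_eq F fun Z => by
    rw [gm_lieRxiPh h, two_smul_dOne_et_swap, hX.2, smul_zero, neg_zero, gm_zero_right]

theorem InE4m_of_lieRxiPh_eq_zero (h : Cyclic a b c) {X : V} (hX : Horiz F V X)
    (h0 : lieRxiPh F V a b X = 0) : InE4m F V X := by
  have h1 : lieRxiPh F V c a X = 0 := by rw [hX.lieRxiPh_eq_neg_ph h, h0, ph_zero, neg_zero]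
  have h2 : lieRxiPh F V b c X = 0 := by
    rw [hX.lieRxiPh_eq_neg_ph h.rotate.rotate, h1, ph_zero, neg_zero]
  refine ⟨hX, fun d Y => ?_⟩
  suffices hd : (2 : ℝ) • dOne F V (et F V d) X Y = 0 from
    (smul_eq_zero_iff_right two_ne_zero).mp hd
  rw [two_smul_dOne_et_swap]
  rcases h.exhaust d with rfl | rfl | rfl
  · rw [← gm_lieRxiPh h.rotate, h2, gm_zero_right, neg_zero]
  · rw [← gm_lieRxiPh h.rotate.rotate, h1, gm_zero_right, neg_zero]
  · rw [← gm_lieRxiPh h, h0, gm_zero_right, neg_zero]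

theorem eq_zero_of_InE4l_of_InE4m {X : V} (hl : InE4l F V X) (hm : InE4m F V X) : X = 0 := by
  refine eq_of_gm_eq F fun Z => ?_
  obtain ⟨Y, W, hY, hW, hYW⟩ := ThreeQS.horiz_split _ (horiz_horComp (F := F) Z)
  rw [horComp_add_sum (F := F) Z, hYW, gm_zero_right, Fin.sum_univ_three]
  simp only [gm_add_left, gm_comm (_ • _) X, gm_smul_right, ← et_eq, hl.1 _]
  rw [hY.2 X hm, gm_comm, hl.2 W hW]
  ring

theorem lieRxiPh_of_InE4l (h : Cyclic a b c) {X : V} (hX : InE4l F V X) :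
    lieRxiPh F V a b X = algebraMap ℝ F (cc F V) • ph F V c X := by
  have hH : Horiz F V
      (lieRxiPh F V a b X - algebraMap ℝ F (cc F V) • ph F V c X) :=
    (hX.1.lieRxiPh a b).sub ((horiz_ph hX.1 c).smul _)
  rw [← sub_eq_zero]
  apply eq_zero_of_InE4l_of_InE4m (F := F)
  · refine ⟨hH, fun Z hZ => ?_⟩
    rw [gm_comm, gm_sub_right, gm_lieRxiPh h, hZ.2, gm_smul_right, gm_comm Z,
      (ThreeQS.phi_E4l c X hX).2 Z hZ]
    simp
  · refine InE4m_of_lieRxiPh_eq_zero h hH ?_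
    change lieRxiPhLin F V a b _ = 0
    rw [map_sub, map_smul]
    change lieRxiPh F V a b _ - _ • lieRxiPh F V a b _ = 0
    rw [hX.1.lieRxiPh_lieRxiPh h.rotate, hX.1.lieRxiPh_ph_comm h.rotate,
      hX.1.ph_lieRxiPh_eq h.rotate, sub_self]

theorem lieRxiPh_rxi (h : Cyclic a b c) (d : Fin 3) :
    lieRxiPh F V a b (rxi F V d) = algebraMap ℝ F (cc F V) • ph F V c (rxi F V d) := by
  rw [lieRxiPh]
  rcases h.exhaust d with rfl | rfl | rfl
  · rw [ph_rxi_left h, lie_neg_right, lie_rxi_rxi' h.rotate.rotate, lie_self, ph_zero,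
      ph_rxi_right h.rotate.rotate]
    abel
  · rw [ph_rxi_self, lie_zero_right, lie_rxi_rxi h, ph_smul, ph_rxi_right h.rotate,
      ph_rxi_left h.rotate, smul_neg, zero_sub]
  · rw [ph_rxi_right h.rotate, lie_self, lie_rxi_rxi' h.rotate.rotate, ph_neg, ph_smul,
      ph_rxi_self, ph_rxi_self]
    simp

theorem smul_psiT_rxi (α d : Fin 3) :
    algebraMap ℝ F (cc F V) • psiT F V α (rxi F V d)
      = algebraMap ℝ F (cc F V) • ph F V α (rxi F V d) := by
  by_cases hc : cc F V = 0
  · simp [hc]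
  · exact congrArg _ (ThreeQS.psi_vert_of_ne hc α d)

variable (F V) in
/-- The tensor `ψ_α` as a linear map. -/
def psiLin (α : Fin 3) : V →ₗ[F] V where
  toFun := psiT F V α
  map_add' := ThreeQS.psi_add α
  map_smul' := ThreeQS.psi_smul α

theorem lieRxiPh_eq (h : Cyclic a b c) (X : V) :
    lieRxiPh F V a b X = algebraMap ℝ F (cc F V) • psiT F V c X := by
  have hxi (d : Fin 3) : lieRxiPhLin F V a b (rxi F V d)
      = (algebraMap ℝ F (cc F V) • psiLin F V c) (rxi F V d) :=
    (lieRxiPh_rxi h d).trans (smul_psiT_rxi c d).symm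
  have hl {Y : V} (hY : InE4l F V Y) : lieRxiPhLin F V a b Y
      = (algebraMap ℝ F (cc F V) • psiLin F V c) Y :=
    (lieRxiPh_of_InE4l h hY).trans (congrArg _ (ThreeQS.psi_E4l c Y hY).symm)
  have hm {Y : V} (hY : InE4m F V Y) : lieRxiPhLin F V a b Y
      = (algebraMap ℝ F (cc F V) • psiLin F V c) Y :=
    (lieRxiPh_of_InE4m h hY).trans <|
      (smul_zero _).symm.trans (congrArg _ (ThreeQS.psi_E4m c Y hY).symm)
  obtain ⟨Y, Z, hY, hZ, hYZ⟩ := ThreeQS.horiz_split _ (horiz_horComp (F := F) X)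
  change lieRxiPhLin F V a b X = (algebraMap ℝ F (cc F V) • psiLin F V c) X
  rw [horComp_add_sum (F := F) X, hYZ]
  simp only [map_add, map_sum, map_smul, hxi, hl hY, hm hZ]

end QuasiSasakian

/-- In any 3-quasi-Sasakian manifold, for every cyclic
permutation `(α,β,γ)` of `{1,2,3}`,
`L_{ξ_α} φ_β = c ψ_γ` where `[ξ_α, ξ_β] = c ξ_γ`. -/
theorem lie_xi_phi_eq (F V : Type) [CommRing F] [Algebra ℝ F] [AddCommGroup V] [Module F V]
    [SmoothSetting F V] [ACM3 F V] [ThreeQS F V] :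
    ∀ a b c' : Fin 3, Cyclic a b c' → ∀ X : V,
      lie F V (rxi F V a) (ph F V b X) - ph F V b (lie F V (rxi F V a) X)
        = algebraMap ℝ F (cc F V) • psiT F V c' X := by
  exact fun a b c' h X => lieRxiPh_eq h X

end QS3
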